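/- arXiv:1211.0573 — 2 statements merged into one kernel-verified Lean document; each statement's English description precedes it below -/
import Mathlib

section
/- For any unit vector |Ψ⟩ in ℂ^N ⊗ ℂ^N, the pure-state collectibility Y^max[|Ψ⟩] = max over orthonormal separable families {|χ_j^sep⟩}_{j=1}^N of ∏_{j=1}^N |⟨Ψ|χ_j^sep⟩|² satisfies Y^max[|Ψ⟩] = (1 + (N−1)·𝒩[|Ψ⟩])^N / N^{2N}, where 𝒩[|Ψ⟩] = (‖(|Ψ⟩⟨Ψ|)^{T_B}‖_1 − 1)/(N−1) is the negativity. -/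
namespace Collectibility

open Finset Matrix

variable {n : Type*} [Fintype n] [DecidableEq n]

open ComplexOrder in
/-- Singular value decomposition of a square complex matrix. -/
theorem exists_svd (C : Matrix n n ℂ) :
    ∃ U ∈ unitaryGroup n ℂ, ∃ V ∈ unitaryGroup n ℂ, ∃ d : n → ℝ, (∀ i, 0 ≤ d i) ∧
      C = U * diagonal (fun i => (d i : ℂ)) * Vᴴ := by
  have hA := isHermitian_conjTranspose_mul_self C
  set e := hA.eigenvalues with he
  set V : Matrix n n ℂ := hA.eigenvectorUnitary.1 with hV
  have hVm : V ∈ unitaryGroup n ℂ := hA.eigenvectorUnitary.2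
  have he0 : ∀ i, 0 ≤ e i := (posSemidef_conjTranspose_mul_self C).eigenvalues_nonneg
  set K := C * V with hK
  have hKK : Kᴴ * K = diagonal (fun i => (e i : ℂ)) := by
    have h1 := hA.conjStarAlgAut_star_eigenvectorUnitary
    rw [Unitary.conjStarAlgAut_star_apply] at h1
    rw [hK, conjTranspose_mul, Matrix.mul_assoc, ← Matrix.mul_assoc Cᴴ, ← Matrix.mul_assoc]
    exact h1
  have hent (j k : n) : ∑ i, star (K i j) * K i k = if j = k then (e j : ℂ) else 0 := by
    simpa [Matrix.mul_apply, diagonal_apply] using congrFun (congrFun hKK j) k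
  let w : n → EuclideanSpace ℂ n := fun j => WithLp.toLp 2 fun i => K i j / (√(e j) : ℂ)
  have hw : Orthonormal ℂ ({j | e j ≠ 0}.domRestrict w) := by
    rw [orthonormal_iff_ite]
    rintro ⟨j, hj⟩ ⟨k, hk⟩
    have hj' : (√(e j) : ℂ) ≠ 0 := by
      exact_mod_cast (Real.sqrt_pos.2 (lt_of_le_of_ne (he0 j) (Ne.symm hj))).ne'
    have : inner ℂ (w j) (w k) = (∑ i, star (K i j) * K i k) / (√(e j) * √(e k)) := by
      simp only [w, PiLp.inner_apply, Finset.sum_div, RCLike.inner_apply]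
      refine Finset.sum_congr rfl fun i _ => ?_
      simp [Complex.conj_ofReal]
      ring
    simp only [Set.domRestrict_apply, this, hent, Subtype.mk.injEq]
    split_ifs with h
    · subst h
      rw [div_eq_one_iff_eq (mul_ne_zero hj' hj')]
      exact_mod_cast (Real.mul_self_sqrt (he0 j)).symm
    · simp
  obtain ⟨b, hb⟩ := hw.exists_orthonormalBasis_extension_of_card_eq (by simp)
  let U : Matrix n n ℂ := of fun i j => b j i
  have hU : U ∈ unitaryGroup n ℂ := by
    rw [mem_unitaryGroup_iff']
    ext j k
    have := orthonormal_iff_ite.1 b.orthonormal j k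
    rw [PiLp.inner_apply] at this
    simp only [Matrix.mul_apply, star_apply, one_apply, U, of_apply, ← this]
    exact Finset.sum_congr rfl fun i _ => by simp [mul_comm]
  have hUK : U * diagonal (fun i => (√(e i) : ℂ)) = K := by
    ext i j
    rw [mul_diagonal]
    by_cases hj : e j = 0
    · have h0 := hent j j
      have h1 : ∑ i, ‖K i j‖ ^ 2 = 0 := by
        simp only [if_true, hj, RCLike.star_def, Complex.conj_mul'] at h0
        exact_mod_cast h0
      rw [Finset.sum_eq_zero_iff_of_nonneg fun _ _ => by positivity] at h1
      have := h1 i (mem_univ i)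
      simp_all
    · have hj' : (√(e j) : ℂ) ≠ 0 := by
        exact_mod_cast (Real.sqrt_pos.2 (lt_of_le_of_ne (he0 j) (Ne.symm hj))).ne'
      simp [U, hb j hj, w, hj']
  refine ⟨U, hU, V, hVm, fun i => √(e i), fun i => Real.sqrt_nonneg _, ?_⟩
  rw [hUK, hK, Matrix.mul_assoc]
  have : V * Vᴴ = 1 := mem_unitaryGroup_iff.1 hVm
  rw [this, Matrix.mul_one]

/-- The trace norm of a Hermitian matrix, read off from a diagonalization of its square. -/
theorem sum_abs_eigenvalues_eq {A W : Matrix n n ℂ} (hA : A.IsHermitian)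
    (hW : W ∈ unitaryGroup n ℂ) {μ : n → ℝ} (hμ : ∀ i, 0 ≤ μ i)
    (h : A * A = W * diagonal (fun i => ((μ i ^ 2 : ℝ) : ℂ)) * Wᴴ) :
    ∑ i, |hA.eigenvalues i| = ∑ i, μ i := by
  have key {L : Matrix n n ℂ} (hL : L ∈ unitaryGroup n ℂ) (f : n → ℝ) :
      (L * diagonal (fun i => (f i : ℂ)) * Lᴴ).charpoly.roots =
        (univ.val.map f).map (fun x : ℝ => (x : ℂ)) := by
    have h1 : Lᴴ * L = 1 := mem_unitaryGroup_iff'.1 hL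
    rw [charpoly_mul_comm, ← Matrix.mul_assoc, h1, Matrix.one_mul, charpoly_diagonal,
      Polynomial.roots_prod _ _ (Finset.prod_ne_zero_iff.2 fun i _ => Polynomial.X_sub_C_ne_zero _)]
    simp
  set L : Matrix n n ℂ := hA.eigenvectorUnitary.1
  have hL : L ∈ unitaryGroup n ℂ := hA.eigenvectorUnitary.2
  have hLL : Lᴴ * L = 1 := mem_unitaryGroup_iff'.1 hL
  have hAL : A = L * diagonal (fun i => (hA.eigenvalues i : ℂ)) * Lᴴ := by
    have := hA.spectral_theorem
    rwa [Unitary.conjStarAlgAut_apply] at this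
  have hAA : A * A = L * diagonal (fun i => ((hA.eigenvalues i ^ 2 : ℝ) : ℂ)) * Lᴴ := by
    set D := diagonal (fun i => (hA.eigenvalues i : ℂ)) with hD
    calc A * A = L * D * (Lᴴ * L) * D * Lᴴ := by
          rw [hAL]; simp only [Matrix.mul_assoc]
      _ = _ := by
          rw [hLL, Matrix.mul_one, Matrix.mul_assoc L, hD, diagonal_mul_diagonal]
          simp [sq]
  have hm := key hL (fun i => hA.eigenvalues i ^ 2)
  rw [← hAA, h, key hW (fun i => μ i ^ 2)] at hm
  have hm' := congrArg (fun s => (s.map Real.sqrt).sum)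
    (Multiset.map_injective Complex.ofReal_injective hm)
  simpa [Real.sqrt_sq_eq_abs, abs_of_nonneg (hμ _)] using hm'.symm

open Kronecker in
/-- The trace norm of the partial transpose of `|Ψ⟩⟨Ψ|` is the square of the sum of the
Schmidt coefficients of `Ψ`. -/
theorem sum_abs_eigenvalues_partialTranspose {Ψ : n × n → ℂ} {U V : Matrix n n ℂ} {d : n → ℝ}
    (hU : U ∈ unitaryGroup n ℂ) (hV : V ∈ unitaryGroup n ℂ) (hd : ∀ i, 0 ≤ d i)
    (hΨ : (of fun i j => Ψ (i, j)) = U * diagonal (fun i => (d i : ℂ)) * Vᴴ)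
    (hH : (of fun p q : n × n => vecMulVec Ψ (star Ψ) (p.1, q.2) (q.1, p.2)).IsHermitian) :
    ∑ i, |hH.eigenvalues i| = (∑ i, d i) ^ 2 := by
  have hUU : Uᴴ * U = 1 := mem_unitaryGroup_iff'.1 hU
  have hVV : Vᴴ * V = 1 := mem_unitaryGroup_iff'.1 hV
  set C : Matrix n n ℂ := of fun i j => Ψ (i, j) with hC
  set D : Matrix n n ℂ := diagonal (fun i => (d i : ℂ)) with hD
  have hDD : Dᴴ = D := by
    rw [hD, diagonal_conjTranspose]; congr 1; ext i; simp
  have h1 : C * Cᴴ = U * (D * D) * Uᴴ := by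
    calc C * Cᴴ = U * D * (Vᴴ * V) * D * Uᴴ := by
          rw [hΨ]; simp only [conjTranspose_mul, conjTranspose_conjTranspose, hDD, Matrix.mul_assoc]
      _ = _ := by rw [hVV, Matrix.mul_one]; simp only [Matrix.mul_assoc]
  have h2 : Cᴴ * C = V * (D * D) * Vᴴ := by
    calc Cᴴ * C = V * D * (Uᴴ * U) * D * Vᴴ := by
          rw [hΨ]; simp only [conjTranspose_mul, conjTranspose_conjTranspose, hDD, Matrix.mul_assoc]
      _ = _ := by rw [hUU, Matrix.mul_one]; simp only [Matrix.mul_assoc]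
  rw [sum_abs_eigenvalues_eq hH (kronecker_mem_unitary hU hV) (μ := fun p => d p.1 * d p.2)
    (fun p => mul_nonneg (hd _) (hd _)), sq, Finset.sum_mul_sum, Fintype.sum_prod_type]
  have h3 : (diagonal fun p : n × n => (((d p.1 * d p.2) ^ 2 : ℝ) : ℂ)) = (D * D) ⊗ₖ (D * D) := by
    rw [hD, diagonal_mul_diagonal, diagonal_kronecker_diagonal]
    congr 1; ext p; push_cast; ring
  rw [h3, conjTranspose_kronecker, ← mul_kronecker_mul, ← mul_kronecker_mul, ← h1, ← h2]
  ext ⟨i, j⟩ ⟨k, l⟩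
  simp only [Matrix.mul_apply, kronecker_apply, of_apply, vecMulVec_apply, Fintype.sum_prod_type,
    Finset.sum_mul_sum, conjTranspose_apply, hC, Pi.star_apply]
  rw [Finset.sum_comm]
  exact Finset.sum_congr rfl fun x _ => Finset.sum_congr rfl fun y _ => by ring

/-- The overlap of `Ψ` with a product vector, in Schmidt form. -/
theorem star_dotProduct_mul_eq {Ψ : n × n → ℂ} {U V A B : Matrix n n ℂ} {d : n → ℝ}
    (hΨ : (of fun i j => Ψ (i, j)) = U * diagonal (fun i => (d i : ℂ)) * Vᴴ) (j : n) :
    star Ψ ⬝ᵥ (fun p : n × n => A p.1 j * B p.2 j) =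
      ∑ s, (d s : ℂ) * ((Uᴴ * A) s j * (Vᵀ * B) s j) := by
  have h (p : n × n) : Ψ p = ∑ s, U p.1 s * d s * star (V p.2 s) := by
    have := congrFun (congrFun hΨ p.1) p.2
    rw [of_apply] at this
    rw [this, Matrix.mul_apply]
    simp [mul_diagonal]
  simp only [dotProduct, Pi.star_apply, h, star_sum, Finset.sum_mul, Matrix.mul_apply,
    Finset.mul_sum, conjTranspose_apply, transpose_apply]
  rw [Finset.sum_comm]
  refine Finset.sum_congr rfl fun s _ => ?_
  rw [Fintype.sum_prod_type]
  refine Eq.trans ?_ Finset.sum_comm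
  refine Finset.sum_congr rfl fun x _ => Finset.sum_congr rfl fun y _ => ?_
  simp [Complex.conj_ofReal]
  ring

theorem sum_norm_sq_row_eq_one {E : Matrix n n ℂ} (hE : E ∈ unitaryGroup n ℂ) (s : n) :
    ∑ j, ‖E s j‖ ^ 2 = 1 := by
  have h := congrFun (congrFun (mem_unitaryGroup_iff.1 hE) s) s
  simp only [Matrix.mul_apply, star_apply, one_apply_eq, RCLike.star_def, Complex.mul_conj'] at h
  exact_mod_cast h

theorem sum_norm_sum_le {E G : Matrix n n ℂ} (hE : E ∈ unitaryGroup n ℂ)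
    (hG : G ∈ unitaryGroup n ℂ) {d : n → ℝ} (hd : ∀ i, 0 ≤ d i) :
    ∑ j, ‖∑ s, (d s : ℂ) * (E s j * G s j)‖ ≤ ∑ s, d s := by
  calc ∑ j, ‖∑ s, (d s : ℂ) * (E s j * G s j)‖
      ≤ ∑ j, ∑ s, d s * ((‖E s j‖ ^ 2 + ‖G s j‖ ^ 2) / 2) := by
        refine Finset.sum_le_sum fun j _ => (norm_sum_le _ _).trans ?_
        refine Finset.sum_le_sum fun s _ => ?_
        rw [norm_mul, norm_mul, Complex.norm_real, Real.norm_of_nonneg (hd s)]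
        refine mul_le_mul_of_nonneg_left ?_ (hd s)
        nlinarith [sq_nonneg (‖E s j‖ - ‖G s j‖)]
    _ = ∑ s, d s := by
        rw [Finset.sum_comm]
        refine Finset.sum_congr rfl fun s _ => ?_
        rw [← Finset.mul_sum, ← Finset.sum_div, Finset.sum_add_distrib,
          sum_norm_sq_row_eq_one hE, sum_norm_sq_row_eq_one hG]
        norm_num

theorem prod_le_sum_div_card_pow {N : ℕ} (hN : N ≠ 0) {x : Fin N → ℝ} (hx : ∀ j, 0 ≤ x j) :
    ∏ j, x j ≤ ((∑ j, x j) / N) ^ N := by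
  have h := Real.geom_mean_le_arith_mean univ (fun _ => (1 : ℝ)) x (fun _ _ => zero_le_one)
    (by simp; omega) (fun j _ => hx j)
  simp only [Real.rpow_one, sum_const, card_univ, Fintype.card_fin, nsmul_eq_mul, mul_one,
    one_mul] at h
  have h0 : 0 ≤ ∏ j, x j := Finset.prod_nonneg fun j _ => hx j
  calc ∏ j, x j = ((∏ j, x j) ^ ((N : ℝ)⁻¹)) ^ N := (Real.rpow_inv_natCast_pow h0 hN).symm
    _ ≤ _ := pow_le_pow_left₀ (Real.rpow_nonneg h0 _) h N

/-- There is a unitary matrix all of whose entries have modulus `1 / √N`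
(the discrete Fourier transform). -/
theorem exists_unitary_mul_star_eq {N : ℕ} (hN : N ≠ 0) :
    ∃ F ∈ unitaryGroup (Fin N) ℂ, ∀ s j, F s j * star (F s j) = (N : ℂ)⁻¹ := by
  have hζ := Complex.isPrimitiveRoot_exp N hN
  set ζ := Complex.exp (2 * Real.pi * Complex.I / N)
  have hζn : ‖ζ‖ = 1 := hζ.norm'_eq_one hN
  have hζ1 : ζ * star ζ = 1 := by
    rw [RCLike.star_def, Complex.mul_conj', hζn]; norm_num
  have hr : ((√(N : ℝ) : ℝ) : ℂ)⁻¹ * ((√(N : ℝ) : ℝ) : ℂ)⁻¹ = (N : ℂ)⁻¹ := by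
    rw [← mul_inv, ← Complex.ofReal_mul, Real.mul_self_sqrt (Nat.cast_nonneg N)]; simp
  have hN' : (N : ℂ) ≠ 0 := by exact_mod_cast hN
  refine ⟨of fun s j : Fin N => ((√(N : ℝ) : ℝ) : ℂ)⁻¹ * (ζ ^ (s : ℕ)) ^ (j : ℕ), ?_, fun s j => ?_⟩
  · rw [mem_unitaryGroup_iff]
    ext s t
    have h1 : ((of fun s j : Fin N => ((√(N : ℝ) : ℝ) : ℂ)⁻¹ * (ζ ^ (s : ℕ)) ^ (j : ℕ)) *
        star (of fun s j : Fin N => ((√(N : ℝ) : ℝ) : ℂ)⁻¹ * (ζ ^ (s : ℕ)) ^ (j : ℕ))) s t =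
        (N : ℂ)⁻¹ * ∑ k ∈ range N, (ζ ^ (s : ℕ) * star ζ ^ (t : ℕ)) ^ k := by
      rw [Matrix.mul_apply, ← Fin.sum_univ_eq_sum_range, Finset.mul_sum]
      refine Finset.sum_congr rfl fun k _ => ?_
      simp only [star_apply, of_apply, star_mul', star_pow, star_inv₀, RCLike.star_def,
        Complex.conj_ofReal, ← hr, mul_pow]
      ring
    rw [h1, one_apply]
    split_ifs with hst
    · subst hst
      simp_rw [← mul_pow, hζ1, one_pow]
      simp [hN']
    · have hw1 : ζ ^ (s : ℕ) * star ζ ^ (t : ℕ) ≠ 1 := by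
        intro hw
        apply hst
        apply Fin.ext
        apply hζ.pow_inj s.2 t.2
        calc ζ ^ (s : ℕ) = ζ ^ (s : ℕ) * (ζ * star ζ) ^ (t : ℕ) := by rw [hζ1]; simp
          _ = (ζ ^ (s : ℕ) * star ζ ^ (t : ℕ)) * ζ ^ (t : ℕ) := by rw [mul_pow]; ring
          _ = ζ ^ (t : ℕ) := by rw [hw, one_mul]
      have hwN : (ζ ^ (s : ℕ) * star ζ ^ (t : ℕ)) ^ N = 1 := by
        rw [mul_pow, ← pow_mul, ← pow_mul, mul_comm (s : ℕ), mul_comm (t : ℕ), pow_mul, pow_mul,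
          ← star_pow, hζ.pow_eq_one]
        simp
      have := mul_geom_sum (ζ ^ (s : ℕ) * star ζ ^ (t : ℕ)) N
      rw [hwN, sub_self, mul_eq_zero, or_iff_right (sub_ne_zero.2 hw1)] at this
      rw [this, mul_zero]
  · calc _ = (((√(N : ℝ) : ℝ) : ℂ)⁻¹ * ((√(N : ℝ) : ℝ) : ℂ)⁻¹) *
        ((ζ * star ζ) ^ (s : ℕ)) ^ (j : ℕ) := by
          simp only [of_apply, star_mul', star_pow, star_inv₀, RCLike.star_def,
            Complex.conj_ofReal, mul_pow]
          ring
      _ = _ := by rw [hζ1, hr]; simp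

theorem mem_unitaryGroup_iff_columns {A : Matrix n n ℂ} :
    A ∈ unitaryGroup n ℂ ↔
      ∀ j k, star (fun i => A i j) ⬝ᵥ (fun i => A i k) = if j = k then (1 : ℂ) else 0 := by
  rw [mem_unitaryGroup_iff', ← Matrix.ext_iff]
  rfl

theorem transpose_mem_unitaryGroup {A : Matrix n n ℂ} (hA : A ∈ unitaryGroup n ℂ) :
    Aᵀ ∈ unitaryGroup n ℂ := by
  rw [mem_unitaryGroup_iff]
  have h := congrArg transpose (mem_unitaryGroup_iff'.1 hA)
  rwa [transpose_mul, transpose_one] at h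

end Collectibility

open Collectibility in
open Finset Matrix in
/-- The pure-state collectibility of a bipartite unit vector `Ψ` equals
`(1 + (N-1)·𝒩[Ψ])^N / N^{2N}` where `𝒩` is the negativity, defined via the trace
norm (sum of absolute eigenvalues) of the partial transpose of `|Ψ⟩⟨Ψ|`. -/
theorem collectibility_eq_negativity {N : ℕ} (hN : 2 ≤ N)
    (Ψ : Fin N × Fin N → ℂ) (hΨ : ∑ p, ‖Ψ p‖ ^ 2 = 1)
    (hH : (Matrix.of fun p q : Fin N × Fin N =>
        Matrix.vecMulVec Ψ (star Ψ) (p.1, q.2) (q.1, p.2)).IsHermitian) :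
    ∃ M : ℝ,
      IsGreatest
        { y : ℝ | ∃ a b : Fin N → Fin N → ℂ,
            (∀ j k, star (a j) ⬝ᵥ a k = if j = k then (1 : ℂ) else 0) ∧
            (∀ j k, star (b j) ⬝ᵥ b k = if j = k then (1 : ℂ) else 0) ∧
            y = ∏ j : Fin N,
              ‖star Ψ ⬝ᵥ (fun p : Fin N × Fin N => a j p.1 * b j p.2)‖ ^ 2 } M ∧
      M = (1 + ((N : ℝ) - 1) *
            (((∑ i, |hH.eigenvalues i|) - 1) / ((N : ℝ) - 1))) ^ N / (N : ℝ) ^ (2 * N) := by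
  have hN0 : N ≠ 0 := by omega
  have hN1 : (N : ℝ) - 1 ≠ 0 := by
    have : (2 : ℝ) ≤ N := by exact_mod_cast hN
    linarith
  obtain ⟨U, hU, V, hV, d, hd, hC⟩ := exists_svd (of fun i j => Ψ (i, j))
  have hUt : Uᴴ ∈ unitaryGroup (Fin N) ℂ := Unitary.star_mem hU
  have hVt : Vᵀ ∈ unitaryGroup (Fin N) ℂ := transpose_mem_unitaryGroup hV
  rw [sum_abs_eigenvalues_partialTranspose hU hV hd hC hH, mul_div_cancel₀ _ hN1,
    add_sub_cancel, ← pow_mul, ← div_pow]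
  refine ⟨_, ⟨?_, ?_⟩, rfl⟩
  · obtain ⟨F, hF, hFF⟩ := exists_unitary_mul_star_eq hN0
    have hA : U * F ∈ unitaryGroup (Fin N) ℂ := mul_mem hU hF
    have hB : Vᵀᴴ * Fᴴᵀ ∈ unitaryGroup (Fin N) ℂ :=
      mul_mem (Unitary.star_mem hVt) (transpose_mem_unitaryGroup (Unitary.star_mem hF))
    refine ⟨fun j i => (U * F) i j, fun j i => (Vᵀᴴ * Fᴴᵀ) i j,
      mem_unitaryGroup_iff_columns.1 hA, mem_unitaryGroup_iff_columns.1 hB, ?_⟩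
    have h1 : Uᴴ * (U * F) = F := by
      rw [← Matrix.mul_assoc, show Uᴴ * U = 1 from mem_unitaryGroup_iff'.1 hU, Matrix.one_mul]
    have h2 : Vᵀ * (Vᵀᴴ * Fᴴᵀ) = Fᴴᵀ := by
      rw [← Matrix.mul_assoc, show Vᵀ * Vᵀᴴ = 1 from mem_unitaryGroup_iff.1 hVt, Matrix.one_mul]
    have h3 (j : Fin N) : ‖star Ψ ⬝ᵥ (fun p : Fin N × Fin N =>
        (U * F) p.1 j * (Vᵀᴴ * Fᴴᵀ) p.2 j)‖ = (∑ s, d s) / N := by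
      rw [star_dotProduct_mul_eq hC, h1, h2]
      simp only [transpose_apply, conjTranspose_apply, hFF]
      rw [← Finset.sum_mul, ← Complex.ofReal_sum, norm_mul, Complex.norm_real,
        Real.norm_of_nonneg (Finset.sum_nonneg fun s _ => hd s), norm_inv, Complex.norm_natCast,
        div_eq_mul_inv]
    simp only [h3, prod_const, card_univ, Fintype.card_fin, ← pow_mul]
  · rintro y ⟨a, b, ha, hb, rfl⟩
    have hE := mul_mem hUt (mem_unitaryGroup_iff_columns (A := of fun i j => a j i) |>.2 ha)
    have hG := mul_mem hVt (mem_unitaryGroup_iff_columns (A := of fun i j => b j i) |>.2 hb)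
    have h1 : ∑ j, ‖star Ψ ⬝ᵥ (fun p : Fin N × Fin N => a j p.1 * b j p.2)‖ ≤ ∑ s, d s := by
      refine le_trans (le_of_eq ?_) (sum_norm_sum_le hE hG hd)
      exact Finset.sum_congr rfl fun j _ => congrArg _ (star_dotProduct_mul_eq
        (A := of fun i j => a j i) (B := of fun i j => b j i) hC j)
    rw [prod_pow, mul_comm 2 N, pow_mul]
    refine pow_le_pow_left₀ (Finset.prod_nonneg fun _ _ => norm_nonneg _) ?_ 2
    refine (prod_le_sum_div_card_pow hN0 fun _ => norm_nonneg _).trans ?_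
    gcongr
end

section
/- Let ρ_AB be a separable two-qubit density matrix, and define for two complementary measurement bases the quantities G_{++} = √Tr(A_+²), G_{--} = √Tr(A_−²), |G_{+-}|² = Tr(A_+A_−), where A_± are the unnormalized conditional Bob states under Alice's σ_z measurement, satisfying the remote-purity conditions Tr((A_±/Tr A_±)²) ≥ 1 − ε_± and Tr((A_±'/Tr A_±')²) ≥ 1 − ε_±' with A_±' = (ρ_B ± X)/2, ρ_B = A_+ + A_−, X = C + C†. Then G_{++}G_{--} − |G_{+-}|² ≤ (η + (G_{++}+G_{--})² − 1)/2, where η = 8 p_+ p_− √(ε_+ε_−) + 2 max(ε_+', ε_−') and p_± = Tr A_±. -/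
open scoped ComplexOrder Matrix in
/-- Every principal `2 × 2` minor of a positive semidefinite matrix is nonnegative. -/
theorem Matrix.PosSemidef.principal_minor_nonneg {n : Type*} [Fintype n]
    {N : Matrix n n ℂ} (hN : N.PosSemidef) (i j : n) :
    0 ≤ (N i i * N j j - N i j * N j i).re := by
  have h := (hN.submatrix ![i, j]).det_nonneg
  rw [Matrix.det_fin_two] at h
  simpa using (Complex.le_def.1 h).1

open Finset in
theorem sum_conj_mul_wedge {m : Type*} [Fintype m] (a b c d : m → ℂ) :
    ∑ x : m × m, star (a x.1 * b x.2 - b x.1 * a x.2) * (c x.1 * d x.2 - d x.1 * c x.2)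
      = 2 * ((∑ k, star (a k) * c k) * (∑ k, star (b k) * d k)
        - (∑ k, star (a k) * d k) * (∑ k, star (b k) * c k)) := by
  have key (p q r s : m → ℂ) : ∑ x : m × m, star (p x.1) * r x.1 * (star (q x.2) * s x.2)
      = (∑ k, star (p k) * r k) * (∑ k, star (q k) * s k) := by
    rw [Fintype.sum_prod_type, sum_mul_sum]
  have expand (x : m × m) :
      star (a x.1 * b x.2 - b x.1 * a x.2) * (c x.1 * d x.2 - d x.1 * c x.2)
      = star (a x.1) * c x.1 * (star (b x.2) * d x.2)
        - star (a x.1) * d x.1 * (star (b x.2) * c x.2)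
        - star (b x.1) * c x.1 * (star (a x.2) * d x.2)
        + star (b x.1) * d x.1 * (star (a x.2) * c x.2) := by
    simp only [star_sub, star_mul']
    ring
  simp only [expand, sum_add_distrib, sum_sub_distrib, key]
  ring

open Finset in
open scoped ComplexOrder MatrixOrder Matrix Matrix.Norms.L2Operator in
/-- Cauchy–Schwarz for the second compound of a positive semidefinite matrix: a `2 × 2` minor is
bounded by the two principal minors on its rows and on its columns. -/
theorem Matrix.PosSemidef.normSq_minor_le {n : Type*} [Fintype n]
    {N : Matrix n n ℂ} (hN : N.PosSemidef) (i j k l : n) :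
    ‖N i k * N j l - N i l * N j k‖ ^ 2
      ≤ (N i i * N j j - N i j * N j i).re * (N k k * N l l - N k l * N l k).re := by
  classical
  obtain ⟨V, rfl⟩ := CStarAlgebra.nonneg_iff_eq_star_mul_self.mp hN.nonneg
  rw [Matrix.star_eq_conjTranspose]
  let wedge (p q : n) : EuclideanSpace ℂ (n × n) :=
    WithLp.toLp 2 fun x => V x.1 p * V x.2 q - V x.1 q * V x.2 p
  have hinner (p q r s : n) : inner ℂ (wedge p q) (wedge r s)
      = 2 * ((Vᴴ * V) p r * (Vᴴ * V) q s - (Vᴴ * V) p s * (Vᴴ * V) q r) := by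
    have h := sum_conj_mul_wedge (fun x => V x p) (fun x => V x q) (fun x => V x r) (fun x => V x s)
    simp only [Matrix.mul_apply, Matrix.conjTranspose_apply]
    rw [← h, PiLp.inner_apply]
    refine sum_congr rfl fun x _ => ?_
    simp only [wedge, RCLike.inner_apply, starRingEnd_apply]
    ring
  have hnorm (p q : n) : ‖wedge p q‖ ^ 2
      = 2 * ((Vᴴ * V) p p * (Vᴴ * V) q q - (Vᴴ * V) p q * (Vᴴ * V) q p).re := by
    rw [← inner_self_eq_norm_sq (𝕜 := ℂ), hinner]
    simp
  have hcs := norm_inner_le_norm (𝕜 := ℂ) (wedge i j) (wedge k l)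
  have hsq := pow_le_pow_left₀ (norm_nonneg _) hcs 2
  rw [mul_pow, hnorm, hnorm, hinner, norm_mul, mul_pow] at hsq
  norm_num at hsq
  simp only [Complex.sub_re, Complex.mul_re] at *
  linarith

open scoped ComplexOrder Matrix in
/-- The partial transpose of a separable matrix, added to the matrix, is positive semidefinite. -/
theorem posSemidef_add_partialTranspose_of_separable
    {ρ : Matrix (Fin 2 × Fin 2) (Fin 2 × Fin 2) ℂ}
    (hsep : ∃ (m : ℕ) (w : Fin m → ℝ) (A B : Fin m → Matrix (Fin 2) (Fin 2) ℂ),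
      (∀ k, 0 ≤ w k) ∧ (∀ k, (A k).PosSemidef) ∧ (∀ k, (B k).PosSemidef) ∧
      ρ = ∑ k, ((w k : ℝ) : ℂ) • Matrix.kroneckerMap (· * ·) (A k) (B k)) :
    (Matrix.of fun x y : Fin 2 × Fin 2 => ρ x y + ρ (y.1, x.2) (x.1, y.2)).PosSemidef := by
  obtain ⟨m, w, A, B, hw, hA, hB, rfl⟩ := hsep
  have hsum : (∑ k, ((w k : ℝ) : ℂ) •
      Matrix.kroneckerMap (· * ·) (A k + (A k)ᵀ) (B k)).PosSemidef :=
    Matrix.posSemidef_sum _ fun k _ =>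
      (((hA k).add (hA k).transpose).kronecker (hB k)).smul (by exact_mod_cast hw k)
  convert hsum using 1
  ext x y
  simp only [Matrix.of_apply, Matrix.sum_apply, Matrix.smul_apply, Matrix.kroneckerMap_apply,
    Matrix.add_apply, Matrix.transpose_apply, smul_eq_mul, ← Finset.sum_add_distrib]
  exact Finset.sum_congr rfl fun k _ => by ring

/-- A bound `d ^ 2 ≤ 16 * (a * b)` in terms of the determinants `a` and `b` of two positive
`2 × 2` matrices of traces `p` and `q` becomes a bound in terms of their impurities `ε` and `δ`. -/
theorem neg_le_of_sq_le_of_purity {a b p q ε δ d : ℝ} (hb : 0 ≤ b) (hp : 0 ≤ p)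
    (hq : 0 ≤ q) (hε : 0 ≤ ε) (hδ : 0 ≤ δ) (hpa : 2 * a ≤ ε * p ^ 2) (hqb : 2 * b ≤ δ * q ^ 2)
    (hd : d ^ 2 ≤ 16 * (a * b)) : -d ≤ 2 * p * q * Real.sqrt (ε * δ) := by
  have hs : 0 ≤ 2 * p * q * Real.sqrt (ε * δ) := by positivity
  have hab : 2 * a * (2 * b) ≤ ε * p ^ 2 * (δ * q ^ 2) :=
    mul_le_mul hpa hqb (by positivity) (by positivity)
  have hsq : (2 * p * q * Real.sqrt (ε * δ)) ^ 2 = 4 * (ε * p ^ 2 * (δ * q ^ 2)) := by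
    rw [mul_pow, Real.sq_sqrt (mul_nonneg hε hδ)]
    ring
  exact neg_le.1 (abs_le_of_sq_le_sq' (by linarith) hs).1

/-- Averaging the purity bounds for `(r ± X) / 2`, where `R`, `T` are the traces of the squares of `r`
and `X`, the trace of `r` is `1`, and `x` is the trace of `X`. -/
theorem purity_add_le {R T x ε δ P Q : ℝ} (hε : 0 ≤ ε) (hx : x ^ 2 ≤ 1)
    (hPQ : 2 * (P + Q) = R + T) (hP : (1 - ε) * ((1 + x) / 2) ^ 2 ≤ P)
    (hQ : (1 - δ) * ((1 - x) / 2) ^ 2 ≤ Q) : 1 + x ^ 2 - 2 * max ε δ ≤ R + T := by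
  have hm : 0 ≤ max ε δ := hε.trans (le_max_left _ _)
  have h₁ := mul_le_mul_of_nonneg_right (le_max_left ε δ) (sq_nonneg ((1 + x) / 2))
  have h₂ := mul_le_mul_of_nonneg_right (le_max_right ε δ) (sq_nonneg ((1 - x) / 2))
  nlinarith [mul_nonneg hm (sub_nonneg.2 hx)]

open Finset Matrix in
open scoped ComplexOrder in
/-- Theorem 1 of the paper: any separable two-qubit state satisfying the remote-purity
conditions obeys `G₊₊G₋₋ − |G₊₋|² ≤ (η + (G₊₊+G₋₋)² − 1)/2`, where
`η = 8p₊p₋√(ε₊ε₋) + 2 max(ε₊', ε₋')`. -/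
theorem separable_G_inequality
    (ρ : Matrix (Fin 2 × Fin 2) (Fin 2 × Fin 2) ℂ) (hρ : ρ.PosSemidef)
    (htr : ρ.trace = 1)
    (hsep : ∃ (m : ℕ) (w : Fin m → ℝ) (A B : Fin m → Matrix (Fin 2) (Fin 2) ℂ),
      (∀ k, 0 ≤ w k) ∧ (∀ k, (A k).PosSemidef) ∧ (∀ k, (B k).PosSemidef) ∧
      ρ = ∑ k, ((w k : ℝ) : ℂ) • Matrix.kroneckerMap (· * ·) (A k) (B k))
    (Ap Am C App Amp : Matrix (Fin 2) (Fin 2) ℂ)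
    (hAp : ∀ b b' : Fin 2, Ap b b' = ρ (0, b) (0, b'))
    (hAm : ∀ b b' : Fin 2, Am b b' = ρ (1, b) (1, b'))
    (hC : ∀ b b' : Fin 2, C b b' = ρ (0, b) (1, b'))
    -- `A₊` locally rotated to diagonal form
    (hdiag : Ap 0 1 = 0)
    -- primed (complementary-basis) conditional states `A±' = (ρ_B ± X)/2`
    (hApp : App = ((2 : ℂ))⁻¹ • (Ap + Am + (C + Cᴴ)))
    (hAmp : Amp = ((2 : ℂ))⁻¹ • (Ap + Am - (C + Cᴴ)))
    (pp pm εp εm εp' εm' : ℝ)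
    (hppdef : (pp : ℂ) = Ap.trace) (hpmdef : (pm : ℂ) = Am.trace)
    (hεp : 0 ≤ εp) (hεm : 0 ≤ εm) (hεp' : 0 ≤ εp') (hεm' : 0 ≤ εm')
    -- remote-purity conditions in the first basis: `Tr(σ_±²) ≥ 1 − ε_±`
    (hpurp : (1 - εp) * pp ^ 2 ≤ ((Ap * Ap).trace).re)
    (hpurm : (1 - εm) * pm ^ 2 ≤ ((Am * Am).trace).re)
    -- remote-purity conditions in the complementary basis: `Tr(σ_±'²) ≥ 1 − ε_±'`
    (hpurp' : (1 - εp') * (App.trace.re) ^ 2 ≤ ((App * App).trace).re)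
    (hpurm' : (1 - εm') * (Amp.trace.re) ^ 2 ≤ ((Amp * Amp).trace).re) :
    Real.sqrt ((Ap * Ap).trace).re * Real.sqrt ((Am * Am).trace).re
        - ((Ap * Am).trace).re
      ≤ ((8 * pp * pm * Real.sqrt (εp * εm) + 2 * max εp' εm')
          + (Real.sqrt ((Ap * Ap).trace).re + Real.sqrt ((Am * Am).trace).re) ^ 2
          - 1) / 2 := by
  have hN := posSemidef_add_partialTranspose_of_separable hsep
  have hherm (x y : Fin 2 × Fin 2) : ρ x y = star (ρ y x) := (hρ.isHermitian.apply x y).symm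
  have hre (x y) : (ρ x y).re = (ρ y x).re := by rw [hherm x y]; simp
  have him (x y) : (ρ x y).im = -(ρ y x).im := by rw [hherm x y]; simp
  have hd (x) : 0 ≤ (ρ x x).re := (Complex.le_def.1 (hρ.diag_nonneg (i := x))).1
  have hi (x) : (ρ x x).im = 0 := by linarith [him x x]
  have hz : ρ (0, 0) (0, 1) = 0 := by rw [← hAp, hdiag]
  have hz' : ρ (0, 1) (0, 0) = 0 := by rw [hherm, hz, star_zero]
  have hdetp := hρ.principal_minor_nonneg (0, 0) (0, 1)
  have hdetm := hρ.principal_minor_nonneg (1, 0) (1, 1)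
  have ha₀ := hd (0, 0)
  have ha₁ := hd (0, 1)
  have hb₀ := hd (1, 0)
  have hb₁ := hd (1, 1)
  have hx₀ := hN.principal_minor_nonneg (0, 0) (1, 0)
  have hx₁ := hN.principal_minor_nonneg (0, 1) (1, 1)
  have hminor := hN.normSq_minor_le (0, 0) (0, 1) (1, 0) (1, 1)
  rw [Complex.sq_norm, Complex.normSq_apply] at hminor
  have htr' := congrArg Complex.re htr
  have hpp := congrArg Complex.re hppdef
  have hpm := congrArg Complex.re hpmdef
  simp only [Matrix.of_apply, Matrix.trace, Matrix.diag_apply, Matrix.mul_apply,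
    Fintype.sum_prod_type, Fin.sum_univ_two, hApp, hAmp, Matrix.smul_apply, Matrix.add_apply,
    Matrix.sub_apply, Matrix.conjTranspose_apply, hAp, hAm, hC, hz, hz', smul_eq_mul,
    Complex.add_re, Complex.add_im, Complex.sub_re, Complex.sub_im, Complex.mul_re, Complex.mul_im,
    Complex.ofReal_re, Complex.one_re, Complex.zero_re, Complex.zero_im, Complex.star_def,
    Complex.conj_re, Complex.conj_im, hi, hre (1, 0) (0, 0), hre (1, 1) (0, 1), hre (1, 0) (0, 1),
    hre (1, 1) (0, 0), hre (1, 1) (1, 0), him (1, 0) (0, 0), him (1, 1) (0, 1), him (1, 0) (0, 1),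
    him (1, 1) (0, 0), him (1, 1) (1, 0)] at *
  have hhalf : ((2 : ℂ)⁻¹).re = 1 / 2 := by norm_num
  have hhalf' : ((2 : ℂ)⁻¹).im = 0 := by norm_num
  simp only [hhalf, hhalf', add_zero, zero_add, mul_zero, zero_mul, sub_zero, sub_self,
    zero_sub, neg_add_cancel, add_neg_cancel] at *
  generalize (ρ (0, 0) (0, 0)).re = a₀, (ρ (0, 1) (0, 1)).re = a₁, (ρ (1, 0) (1, 0)).re = b₀,
    (ρ (1, 1) (1, 1)).re = b₁, (ρ (1, 0) (1, 1)).re = u, (ρ (1, 0) (1, 1)).im = v,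
    (ρ (0, 0) (1, 0)).re = x₀, (ρ (0, 1) (1, 1)).re = x₁, (ρ (0, 0) (1, 0)).im = y₀,
    (ρ (0, 1) (1, 1)).im = y₁, (ρ (0, 0) (1, 1)).re = s, (ρ (0, 1) (1, 0)).re = s',
    (ρ (0, 0) (1, 1)).im = t, (ρ (0, 1) (1, 0)).im = t' at *
  have hx₀' : |2 * x₀| ≤ a₀ + b₀ :=
    abs_le_of_sq_le_sq (by linarith [sq_nonneg (a₀ - b₀)]) (by linarith)
  have hx₁' : |2 * x₁| ≤ a₁ + b₁ :=
    abs_le_of_sq_le_sq (by linarith [sq_nonneg (a₁ - b₁)]) (by linarith)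
  have hx : (2 * x₀ + 2 * x₁) ^ 2 ≤ 1 := by
    rw [sq_le_one_iff_abs_le_one]
    linarith [abs_add_le (2 * x₀) (2 * x₁)]
  have hdet : -(4 * x₀ * x₁ - ((s + s') ^ 2 + (t - t') ^ 2)) ≤ 2 * pp * pm * √(εp * εm) := by
    refine neg_le_of_sq_le_of_purity (a := a₀ * a₁) (b := b₀ * b₁ - (u ^ 2 + v ^ 2))
      (by linarith) (by linarith) (by linarith) hεp hεm ?_ ?_ ?_
    · rw [hpp] at hpurp ⊢
      linarith
    · rw [hpm] at hpurm ⊢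
      linarith
    · linarith
  have hplus : 1 / 2 * (a₀ + b₀ + (x₀ + x₀)) + 1 / 2 * (a₁ + b₁ + (x₁ + x₁))
      = (1 + (2 * x₀ + 2 * x₁)) / 2 := by linarith
  have hminus : 1 / 2 * (a₀ + b₀ - (x₀ + x₀)) + 1 / 2 * (a₁ + b₁ - (x₁ + x₁))
      = (1 - (2 * x₀ + 2 * x₁)) / 2 := by linarith
  rw [hplus] at hpurp'
  rw [hminus] at hpurm'
  have hbob := purity_add_le
    (R := (a₀ + b₀) ^ 2 + (a₁ + b₁) ^ 2 + 2 * (u ^ 2 + v ^ 2))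
    (T := (2 * x₀) ^ 2 + (2 * x₁) ^ 2 + 2 * ((s + s') ^ 2 + (t - t') ^ 2))
    hεp' hx (by ring) hpurp' hpurm'
  have hprod : 0 ≤ pp * pm * √(εp * εm) :=
    mul_nonneg (mul_nonneg (by linarith) (by linarith)) (Real.sqrt_nonneg _)
  rw [add_sq, Real.sq_sqrt (by linarith [sq_nonneg a₀, sq_nonneg a₁]),
    Real.sq_sqrt (by linarith [sq_nonneg b₀, sq_nonneg b₁, sq_nonneg u, sq_nonneg v])]
  linarith
end
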